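/- arXiv:0901.0947 — 4 statements merged into one kernel-verified Lean document; each statement's English description precedes it below -/
import Mathlib

section
/- For every integer n ≥ 1 and every z ∈ ℂ with |z| ≠ 1, one has φ_{n+1}(z) ε_n(z) - ε_{n+1}(z) φ_n(z) = 2 α_{n+1} σ_n z^n. -/
open MeasureTheory Complex

noncomputable instance : MeasurableSpace Circle := borel Circle
instance : BorelSpace Circle := ⟨rfl⟩

/-- The topological support of a measure: points all of whose neighbourhoods have
positive measure. -/
def measureSupport (μ : Measure Circle) : Set Circle :=
  {x | ∀ U : Set Circle, IsOpen U → x ∈ U → 0 < μ U}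

/-- `σ_n = ∫ |φ_n|² dμ`, written as `∫ conj(φ_n) · φ_n dμ`. -/
noncomputable def sigmaOP (μ : Measure Circle) (φ : ℕ → Polynomial ℂ) (n : ℕ) : ℂ :=
  ∫ ζ : Circle, (starRingEnd ℂ) ((φ n).eval (ζ : ℂ)) * (φ n).eval (ζ : ℂ) ∂μ

/-- `ε_n(z) = ∫ (ζ+z)/(ζ-z) φ_n(ζ) dμ(ζ)`. -/
noncomputable def epsOP (μ : Measure Circle) (φ : ℕ → Polynomial ℂ) (n : ℕ) (z : ℂ) : ℂ :=
  ∫ ζ : Circle, (((ζ : ℂ) + z) / ((ζ : ℂ) - z)) * (φ n).eval (ζ : ℂ) ∂μ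

/-- every continuous function on the circle is integrable -/
lemma integrable_of_cont (μ : Measure Circle) [IsFiniteMeasure μ] {f : Circle → ℂ}
    (hf : Continuous f) : Integrable f μ :=
  hf.integrable_of_hasCompactSupport (HasCompactSupport.of_compactSpace f)

/-- `L_k(p) = ∫ p(ζ) conj(ζ)^k dμ` -/
noncomputable def Lfun (μ : Measure Circle) [IsFiniteMeasure μ] (k : ℕ) :
    Polynomial ℂ →ₗ[ℂ] ℂ where
  toFun p := ∫ ζ : Circle, p.eval (ζ : ℂ) * ((starRingEnd ℂ) (ζ : ℂ)) ^ k ∂μ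
  map_add' p q := by
    rw [← integral_add]
    · simp only [Polynomial.eval_add, add_mul]
    · exact integrable_of_cont μ (by fun_prop)
    · exact integrable_of_cont μ (by fun_prop)
  map_smul' c p := by
    simp only [Polynomial.eval_smul, smul_eq_mul, RingHom.id_apply, mul_assoc]
    rw [integral_const_mul]

lemma Lfun_apply (μ : Measure Circle) [IsFiniteMeasure μ] (k : ℕ) (p : Polynomial ℂ) :
    Lfun μ k p = ∫ ζ : Circle, p.eval (ζ : ℂ) * ((starRingEnd ℂ) (ζ : ℂ)) ^ k ∂μ := rfl

lemma circle_mul_conj (ζ : Circle) : (ζ : ℂ) * (starRingEnd ℂ) (ζ : ℂ) = 1 := by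
  rw [Complex.mul_conj]; simp

lemma Lfun_X_mul (μ : Measure Circle) [IsFiniteMeasure μ] (k : ℕ) (p : Polynomial ℂ) :
    Lfun μ (k + 1) (Polynomial.X * p) = Lfun μ k p := by
  rw [Lfun_apply, Lfun_apply]
  congr 1; ext ζ
  have := circle_mul_conj ζ
  simp only [Polynomial.eval_mul, Polynomial.eval_X]
  linear_combination (p.eval (ζ : ℂ) * ((starRingEnd ℂ) (ζ : ℂ)) ^ k) * this

lemma sigma_eq (μ : Measure Circle) [IsFiniteMeasure μ] (φ : ℕ → Polynomial ℂ)
    (hmonic : ∀ n, (φ n).Monic) (hdeg : ∀ n, (φ n).natDegree = n)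
    (horth : ∀ n, ∀ k < n, Lfun μ k (φ n) = 0) (n : ℕ) :
    sigmaOP μ φ n = Lfun μ n (φ n) := by
  have h1 : sigmaOP μ φ n = ∑ k ∈ Finset.range (n + 1),
      (starRingEnd ℂ) ((φ n).coeff k) * Lfun μ k (φ n) := by
    simp only [Lfun_apply, ← integral_const_mul]
    rw [← integral_finsetSum]
    · unfold sigmaOP
      congr 1; ext ζ
      conv_lhs => rw [Polynomial.eval_eq_sum_range' (n := n + 1) (by rw [hdeg]; omega) (ζ : ℂ)]
      rw [Polynomial.eval_eq_sum_range' (n := n + 1) (by rw [hdeg]; omega) (ζ : ℂ)]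
      simp only [map_sum, map_mul, map_pow]
      rw [Finset.sum_mul]
      refine Finset.sum_congr rfl fun k _ => ?_
      ring
    · intro k _
      exact integrable_of_cont μ (by fun_prop)
  rw [h1, Finset.sum_range_succ, Finset.sum_eq_zero]
  · have : (φ n).coeff n = 1 := by
      have := hmonic n
      rwa [Polynomial.Monic, Polynomial.leadingCoeff, hdeg] at this
    simp [this]
  · intro k hk
    rw [horth n k (Finset.mem_range.1 hk), mul_zero]

/-- The bivariate quotient. -/
lemma exists_quot (P R : Polynomial ℂ) (hP : P.Monic) (n : ℕ) (hdP : P.natDegree = n + 1)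
    (hdR : R.natDegree = n) :
    ∃ q : ℕ → Polynomial ℂ, q n = R ∧
      (Polynomial.C (P.coeff 0) * R - Polynomial.C (R.coeff 0) * P = - (Polynomial.X * q 0)) ∧
      (∀ j, Polynomial.C (P.coeff (j + 1)) * R - Polynomial.C (R.coeff (j + 1)) * P
        = q j - Polynomial.X * q (j + 1)) ∧
      (∀ j, n < j → q j = 0) := by
  classical
  set B : Polynomial (Polynomial ℂ) :=
    P.map Polynomial.C * Polynomial.C R - R.map Polynomial.C * Polynomial.C P with hB
  have hroot : B.IsRoot Polynomial.X := by
    simp [hB, Polynomial.IsRoot, Polynomial.eval_map, Polynomial.eval₂_C_X, mul_comm]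
  obtain ⟨q, hq⟩ := Polynomial.dvd_iff_isRoot.2 hroot
  have hBc : ∀ j, B.coeff j = Polynomial.C (P.coeff j) * R - Polynomial.C (R.coeff j) * P := by
    intro j; simp [hB]
  have hstep : ∀ j, Polynomial.C (P.coeff (j + 1)) * R - Polynomial.C (R.coeff (j + 1)) * P
        = q.coeff j - Polynomial.X * q.coeff (j + 1) := by
    intro j
    rw [← hBc, hq, sub_mul]
    simp
  have hz : ∀ j, n < j → q.coeff j = 0 := by
    have hBd : B.natDegree ≤ n + 1 := by
      rw [Polynomial.natDegree_le_iff_coeff_eq_zero]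
      intro N hN
      rw [hBc, Polynomial.coeff_eq_zero_of_natDegree_lt (by omega),
        Polynomial.coeff_eq_zero_of_natDegree_lt (by omega)]
      simp
    intro j hj
    by_cases hq0 : q = 0
    · simp [hq0]
    apply Polynomial.coeff_eq_zero_of_natDegree_lt
    rw [hq, Polynomial.natDegree_mul (Polynomial.X_sub_C_ne_zero _) hq0,
      Polynomial.natDegree_X_sub_C] at hBd
    omega
  refine ⟨q.coeff, ?_, ?_, hstep, hz⟩
  · have h := hstep n
    rw [hz (n + 1) (by omega), Polynomial.coeff_eq_zero_of_natDegree_lt (p := R) (by omega)] at h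
    have h1 : P.coeff (n + 1) = 1 := by
      rwa [Polynomial.Monic, Polynomial.leadingCoeff, hdP] at hP
    rw [h1] at h
    simpa using h.symm
  · rw [← hBc, hq, sub_mul]
    simp

/-- For the monic orthogonal polynomials `φ_n` of a finite positive measure `μ` with
infinite support on the unit circle, with Verblunsky coefficients `α_n = φ_n(0)`,
`σ_n = ∫|φ_n|²dμ` and `ε_n(z) = ∫ (ζ+z)/(ζ-z) φ_n(ζ) dμ(ζ)`, one has, for every `n ≥ 1`
and every `z` with `|z| ≠ 1`:
`φ_{n+1}(z) ε_n(z) - ε_{n+1}(z) φ_n(z) = 2 α_{n+1} σ_n z^n`. -/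
theorem wronskian_phi_eps
    (μ : Measure Circle) [IsFiniteMeasure μ]
    (hsupp : (measureSupport μ).Infinite)
    (φ : ℕ → Polynomial ℂ)
    (hmonic : ∀ n, (φ n).Monic)
    (hdeg : ∀ n, (φ n).natDegree = n)
    (horth : ∀ n, ∀ k < n,
      ∫ ζ : Circle, (φ n).eval (ζ : ℂ) * ((starRingEnd ℂ) (ζ : ℂ)) ^ k ∂μ = 0)
    (n : ℕ) (hn : 1 ≤ n) (z : ℂ) (hz : ‖z‖ ≠ 1) :
    (φ (n + 1)).eval z * epsOP μ φ n z - epsOP μ φ (n + 1) z * (φ n).eval z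
      = 2 * (φ (n + 1)).eval 0 * sigmaOP μ φ n * z ^ n := by
  have horth' : ∀ n, ∀ k < n, Lfun μ k (φ n) = 0 := horth
  have hsig := sigma_eq μ φ hmonic hdeg horth' n
  obtain ⟨q, hqn, hq0, hqs, hqz⟩ := exists_quot (φ (n + 1)) (φ n) (hmonic _) n (hdeg _)
    (hdeg _)
  -- functional identities
  have hC : ∀ (k : ℕ) (a b : ℂ), Lfun μ k (Polynomial.C a * φ n - Polynomial.C b * φ (n + 1))
      = a * Lfun μ k (φ n) - b * Lfun μ k (φ (n + 1)) := by
    intro k a b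
    rw [← Polynomial.smul_eq_C_mul, ← Polynomial.smul_eq_C_mul, map_sub, map_smul, map_smul]
    simp
  have hshift : ∀ i j, i + 1 < n → Lfun μ (i + 1) (q j) = Lfun μ i (q (j + 1)) := by
    intro i j hi
    have h := hC (i + 1) ((φ (n + 1)).coeff (j + 1)) ((φ n).coeff (j + 1))
    rw [hqs, map_sub, Lfun_X_mul, horth' n _ hi, horth' (n + 1) _ (by omega)] at h
    linear_combination h
  have hiter : ∀ i j, i < n → Lfun μ 0 (q (i + j)) = Lfun μ i (q j) := by
    intro i
    induction i with
    | zero => intro j _; simp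
    | succ i ih =>
      intro j hi
      rw [hshift i j hi, ← ih (j + 1) (by omega)]
      congr 2; omega
  have hbase : ∀ i, Lfun μ i (q 0) = -((φ (n + 1)).coeff 0 * Lfun μ (i + 1) (φ n)
      - (φ n).coeff 0 * Lfun μ (i + 1) (φ (n + 1))) := by
    intro i
    have h := hC (i + 1) ((φ (n + 1)).coeff 0) ((φ n).coeff 0)
    rw [hq0, map_neg, Lfun_X_mul] at h
    linear_combination -h
  have hsmall : ∀ j, j + 1 < n → Lfun μ 0 (q j) = 0 := by
    intro j hj
    have h := hiter j 0 (by omega)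
    rw [add_zero] at h
    rw [h, hbase, horth' n _ hj, horth' (n + 1) _ (by omega)]
    ring
  obtain ⟨m, rfl⟩ : ∃ m, n = m + 1 := ⟨n - 1, by omega⟩
  have hmid : Lfun μ 0 (q m) = -((φ (m + 1 + 1)).coeff 0 * sigmaOP μ φ (m + 1)) := by
    have h := hiter m 0 (by omega)
    rw [add_zero] at h
    rw [h, hbase, hsig, horth' (m + 1 + 1) (m + 1) (by omega)]
    ring
  have htop : Lfun μ 0 (q (m + 1)) = 0 := by
    rw [hqn]; exact horth' _ _ (by omega)
  -- the pointwise quotient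
  set S : Polynomial ℂ := ∑ j ∈ Finset.range (m + 1 + 1), z ^ j • q j with hS
  have hLS : Lfun μ 0 S = -(z ^ m * ((φ (m + 1 + 1)).coeff 0 * sigmaOP μ φ (m + 1))) := by
    rw [hS, map_sum, Finset.sum_range_succ, Finset.sum_range_succ, Finset.sum_eq_zero]
    · simp only [map_smul, hmid, htop, smul_eq_mul]; ring
    · intro j hj
      rw [map_smul, hsmall j (by have := Finset.mem_range.1 hj; omega), smul_zero]
  have hpoly : (φ (m + 1 + 1)).eval z • φ (m + 1) - (φ (m + 1)).eval z • φ (m + 1 + 1)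
      = z • S - Polynomial.X * S := by
    rw [Polynomial.eval_eq_sum_range' (n := m + 1 + 1 + 1) (by rw [hdeg]; omega) z,
      Polynomial.eval_eq_sum_range' (p := φ (m + 1)) (n := m + 1 + 1 + 1) (by rw [hdeg]; omega) z,
      Finset.sum_smul, Finset.sum_smul, ← Finset.sum_sub_distrib, Finset.sum_range_succ']
    have e1 : Polynomial.X * S =
        ∑ j ∈ Finset.range (m + 1 + 1 + 1), z ^ j • (Polynomial.X * q j) := by
      rw [Finset.sum_range_succ, hqz (m + 1 + 1) (by omega), hS, Finset.mul_sum]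
      simp
    have e2 : z • S = ∑ j ∈ Finset.range (m + 1 + 1), z ^ (j + 1) • q j := by
      rw [hS, Finset.smul_sum]
      refine Finset.sum_congr rfl fun j _ => ?_
      rw [smul_smul, pow_succ']
    rw [Finset.sum_range_succ'] at e1
    rw [e1, e2, ← sub_sub, ← Finset.sum_sub_distrib, sub_eq_add_neg]
    congr 1
    · refine Finset.sum_congr rfl fun j _ => ?_
      rw [← smul_sub, ← hqs j]
      simp only [Polynomial.smul_eq_C_mul, map_mul]
      ring
    · simp only [pow_zero, mul_one, one_smul, Polynomial.smul_eq_C_mul]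
      exact hq0
  have hne : ∀ ζ : Circle, (ζ : ℂ) - z ≠ 0 := by
    intro ζ h
    apply hz
    rw [← sub_eq_zero.1 h]
    exact Circle.norm_coe ζ
  have hcont : ∀ p : Polynomial ℂ, Continuous fun ζ : Circle =>
      (((ζ : ℂ) + z) / ((ζ : ℂ) - z)) * p.eval (ζ : ℂ) := by
    intro p
    refine Continuous.mul (Continuous.div (by fun_prop) (by fun_prop) hne) (by fun_prop)
  have hW : (φ (m + 1 + 1)).eval z * epsOP μ φ (m + 1) z
      - epsOP μ φ (m + 1 + 1) z * (φ (m + 1)).eval z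
      = Lfun μ 0 ((φ (m + 1 + 1)).eval z • φ (m + 1) - (φ (m + 1)).eval z • φ (m + 1 + 1)
        - (2 * z) • S) := by
    rw [mul_comm (epsOP μ φ (m + 1 + 1) z), Lfun_apply]
    unfold epsOP
    rw [← integral_const_mul, ← integral_const_mul, ← integral_sub
      ((integrable_of_cont μ (hcont _)).const_mul _) ((integrable_of_cont μ (hcont _)).const_mul _)]
    congr 1; ext ζ
    have h := congrArg (Polynomial.eval (ζ : ℂ)) hpoly
    simp only [Polynomial.eval_sub, Polynomial.eval_smul, Polynomial.eval_mul, Polynomial.eval_X,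
      smul_eq_mul, pow_zero, mul_one] at h ⊢
    have h0 := hne ζ
    field_simp
    linear_combination (2 * z) * h
  rw [hW, map_sub, map_sub, map_smul, map_smul, map_smul, hLS, horth' (m + 1) 0 (by omega),
    horth' (m + 1 + 1) 0 (by omega), ← Polynomial.coeff_zero_eq_eval_zero]
  simp only [smul_eq_mul]
  ring
end

section
/- For every integer n ≥ 1 and every z ∈ ℂ with |z| ≠ 1, one has φ_n(z) ε_n*(z) + ε_n(z) φ_n*(z) = 2 σ_n z^n. -/
open MeasureTheory Complex

/-- `ε_n*(z) = -z^n ∫ (ζ+z)/(ζ-z) conj(φ_n(ζ)) dμ(ζ)`. -/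
noncomputable def epsStarOP (μ : Measure Circle) (φ : ℕ → Polynomial ℂ) (n : ℕ) (z : ℂ) : ℂ :=
  -z ^ n * ∫ ζ : Circle, (((ζ : ℂ) + z) / ((ζ : ℂ) - z)) *
    (starRingEnd ℂ) ((φ n).eval (ζ : ℂ)) ∂μ

/-- `φ_n*(z) = z^n conj(φ_n(1/conj z))`, the reversed polynomial. -/
noncomputable def phiStarOP (φ : ℕ → Polynomial ℂ) (n : ℕ) (z : ℂ) : ℂ :=
  z ^ n * (starRingEnd ℂ) ((φ n).eval ((starRingEnd ℂ) z)⁻¹)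

/-- Division of `p(x) - p(w)` by `x - w`, multiplied by `x + w`. -/
lemma exists_divided_diff (p : Polynomial ℂ) (n : ℕ) (hn : 1 ≤ n) (hd : p.natDegree = n) (w : ℂ) :
    ∃ q : Polynomial ℂ, q.natDegree < n ∧
      ∀ x : ℂ, (x + w) * (p.eval x - p.eval w) = (x - w) * (p.eval x + q.eval x) := by
  refine ⟨Polynomial.C (2 * w) * (p /ₘ (Polynomial.X - Polynomial.C w))
    - Polynomial.C (p.eval w), ?_, ?_⟩
  · have h1 : (p /ₘ (Polynomial.X - Polynomial.C w)).natDegree = n - 1 := by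
      rw [Polynomial.natDegree_divByMonic _ (Polynomial.monic_X_sub_C w), hd,
        Polynomial.natDegree_X_sub_C]
    have h2 := Polynomial.natDegree_C_mul_le (2 * w) (p /ₘ (Polynomial.X - Polynomial.C w))
    have h3 := Polynomial.natDegree_sub_le
      (Polynomial.C (2 * w) * (p /ₘ (Polynomial.X - Polynomial.C w))) (Polynomial.C (p.eval w))
    rw [Polynomial.natDegree_C] at h3
    omega
  · intro x
    have h := congrArg (Polynomial.eval x) (Polynomial.modByMonic_add_div p (Polynomial.X - Polynomial.C w))
    rw [Polynomial.modByMonic_X_sub_C_eq_C_eval] at h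
    simp only [Polynomial.eval_add, Polynomial.eval_mul, Polynomial.eval_sub, Polynomial.eval_X,
      Polynomial.eval_C] at h ⊢
    linear_combination (-2 * w) * h

lemma circle_integrable (μ : Measure Circle) [IsFiniteMeasure μ] (f : Circle → ℂ)
    (hf : Continuous f) : Integrable f μ :=
  hf.integrable_of_hasCompactSupport (HasCompactSupport.of_compactSpace f)

lemma orth_conj (μ : Measure Circle) [IsFiniteMeasure μ] (P : Polynomial ℂ) (n : ℕ)
    (horth : ∀ k < n, ∫ ζ : Circle, P.eval (ζ : ℂ) * ((starRingEnd ℂ) (ζ : ℂ)) ^ k ∂μ = 0)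
    (q : Polynomial ℂ) (hq : q.natDegree < n) :
    ∫ ζ : Circle, P.eval (ζ : ℂ) * q.eval ((starRingEnd ℂ) (ζ : ℂ)) ∂μ = 0 := by
  have h : ∀ ζ : Circle, P.eval (ζ : ℂ) * q.eval ((starRingEnd ℂ) (ζ : ℂ)) =
      ∑ k ∈ Finset.range n, q.coeff k * (P.eval (ζ : ℂ) * ((starRingEnd ℂ) (ζ : ℂ)) ^ k) := by
    intro ζ
    rw [Polynomial.eval_eq_sum_range' hq, Finset.mul_sum]
    exact Finset.sum_congr rfl fun k _ => by ring
  simp_rw [h]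
  rw [integral_finsetSum]
  · refine Finset.sum_eq_zero fun k hk => ?_
    rw [integral_const_mul, horth k (Finset.mem_range.1 hk), mul_zero]
  · intro k _
    apply circle_integrable
    have := Complex.continuous_conj
    fun_prop

lemma eval_map_conj (q : Polynomial ℂ) (x : ℂ) :
    (q.map (starRingEnd ℂ)).eval x = (starRingEnd ℂ) (q.eval ((starRingEnd ℂ) x)) := by
  have h := Polynomial.eval_map_apply (starRingEnd ℂ) (p := q) ((starRingEnd ℂ) x)
  simpa using h

lemma orth_poly (μ : Measure Circle) [IsFiniteMeasure μ] (P : Polynomial ℂ) (n : ℕ)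
    (horth : ∀ k < n, ∫ ζ : Circle, P.eval (ζ : ℂ) * ((starRingEnd ℂ) (ζ : ℂ)) ^ k ∂μ = 0)
    (q : Polynomial ℂ) (hq : q.natDegree < n) :
    ∫ ζ : Circle, (starRingEnd ℂ) (P.eval (ζ : ℂ)) * q.eval (ζ : ℂ) ∂μ = 0 := by
  have h := orth_conj μ P n horth (q.map (starRingEnd ℂ))
    (by rwa [Polynomial.natDegree_map])
  have h2 := congrArg (starRingEnd ℂ) h
  rw [← integral_conj] at h2
  simpa [eval_map_conj] using h2

/-- For the monic orthogonal polynomials `φ_n` of a finite positive measure `μ` with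
infinite support on the unit circle, for every `n ≥ 1` and every `z` with `|z| ≠ 1`:
`φ_n(z) ε_n*(z) + ε_n(z) φ_n*(z) = 2 σ_n z^n`. -/
theorem wronskian_phi_epsStar
    (μ : Measure Circle) [IsFiniteMeasure μ]
    (hsupp : (measureSupport μ).Infinite)
    (φ : ℕ → Polynomial ℂ)
    (hmonic : ∀ n, (φ n).Monic)
    (hdeg : ∀ n, (φ n).natDegree = n)
    (horth : ∀ n, ∀ k < n,
      ∫ ζ : Circle, (φ n).eval (ζ : ℂ) * ((starRingEnd ℂ) (ζ : ℂ)) ^ k ∂μ = 0)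
    (n : ℕ) (hn : 1 ≤ n) (z : ℂ) (hz : ‖z‖ ≠ 1) :
    (φ n).eval z * epsStarOP μ φ n z + epsOP μ φ n z * phiStarOP φ n z
      = 2 * sigmaOP μ φ n * z ^ n := by
  by_cases hz0 : z = 0
  · subst hz0
    have : n ≠ 0 := by omega
    simp [epsStarOP, phiStarOP, this]
  obtain ⟨q1, hq1, e1⟩ := exists_divided_diff (φ n) n hn (hdeg n) z
  obtain ⟨q2, hq2, e2⟩ := exists_divided_diff ((φ n).map (starRingEnd ℂ)) n hn
    (by rw [Polynomial.natDegree_map, hdeg]) z⁻¹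
  have o1 := orth_poly μ (φ n) n (horth n) q1 hq1
  have o2 := orth_conj μ (φ n) n (horth n) q2 hq2
  have hcc := Complex.continuous_conj
  have hne : ∀ ζ : Circle, (ζ : ℂ) - z ≠ 0 := by
    intro ζ h
    apply hz
    rw [← sub_eq_zero.1 h]
    exact Circle.norm_coe ζ
  have hK : Continuous fun ζ : Circle => ((ζ : ℂ) + z) / ((ζ : ℂ) - z) :=
    Continuous.div (by fun_prop) (by fun_prop) hne
  set w : ℂ := (starRingEnd ℂ) ((φ n).eval ((starRingEnd ℂ) z)⁻¹) with hw
  have key : ∀ ζ : Circle,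
      w * ((((ζ : ℂ) + z) / ((ζ : ℂ) - z)) * (φ n).eval (ζ : ℂ))
        - (φ n).eval z * ((((ζ : ℂ) + z) / ((ζ : ℂ) - z)) * (starRingEnd ℂ) ((φ n).eval (ζ : ℂ)))
      = ((starRingEnd ℂ) ((φ n).eval (ζ : ℂ)) * (φ n).eval (ζ : ℂ)
          + (starRingEnd ℂ) ((φ n).eval (ζ : ℂ)) * q1.eval (ζ : ℂ))
        + ((starRingEnd ℂ) ((φ n).eval (ζ : ℂ)) * (φ n).eval (ζ : ℂ)
          + (φ n).eval (ζ : ℂ) * q2.eval ((starRingEnd ℂ) (ζ : ℂ))) := by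
    intro ζ
    have a1 := e1 ζ
    have a2 := e2 ((starRingEnd ℂ) (ζ : ℂ))
    have hζ : (ζ : ℂ) ≠ 0 := Circle.coe_ne_zero ζ
    have hu : (ζ : ℂ) * (starRingEnd ℂ) (ζ : ℂ) = 1 := by
      rw [Complex.mul_conj, Circle.normSq_coe]; simp
    have hv : z * z⁻¹ = 1 := mul_inv_cancel₀ hz0
    simp only [eval_map_conj, map_inv₀, Complex.conj_conj] at a2
    rw [← hw] at a2
    generalize (starRingEnd ℂ) ((φ n).eval (ζ : ℂ)) = Pb at *
    generalize q2.eval ((starRingEnd ℂ) (ζ : ℂ)) = b at *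
    generalize (starRingEnd ℂ) (ζ : ℂ) = u at *
    generalize z⁻¹ = v at *
    have a3 : ((ζ : ℂ) + z) * (Pb - w) = (z - ζ) * (Pb + b) := by
      linear_combination (ζ * z) * a2 - z * (Pb - w - Pb - b) * hu - ζ * (Pb - w + Pb + b) * hv
    have := hne ζ
    field_simp
    linear_combination Pb * a1 - (φ n).eval (ζ : ℂ) * a3
  have I1 : Integrable (fun ζ : Circle => (((ζ : ℂ) + z) / ((ζ : ℂ) - z)) * (φ n).eval (ζ : ℂ)) μ :=
    circle_integrable μ _ (hK.mul (by fun_prop))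
  have I2 : Integrable (fun ζ : Circle => (((ζ : ℂ) + z) / ((ζ : ℂ) - z)) *
      (starRingEnd ℂ) ((φ n).eval (ζ : ℂ))) μ :=
    circle_integrable μ _ (hK.mul (by fun_prop))
  have J1 : Integrable (fun ζ : Circle =>
      (starRingEnd ℂ) ((φ n).eval (ζ : ℂ)) * (φ n).eval (ζ : ℂ)) μ :=
    circle_integrable μ _ (by fun_prop)
  have J2 : Integrable (fun ζ : Circle =>
      (starRingEnd ℂ) ((φ n).eval (ζ : ℂ)) * q1.eval (ζ : ℂ)) μ :=
    circle_integrable μ _ (by fun_prop)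
  have J3 : Integrable (fun ζ : Circle =>
      (φ n).eval (ζ : ℂ) * q2.eval ((starRingEnd ℂ) (ζ : ℂ))) μ :=
    circle_integrable μ _ (by fun_prop)
  have H := integral_congr_ae (μ := μ) (Filter.Eventually.of_forall key)
  rw [integral_sub (I1.const_mul _) (I2.const_mul _), integral_const_mul, integral_const_mul,
    integral_add (by exact J1.add J2) (by exact J1.add J3), integral_add J1 J2,
    integral_add J1 J3, o1, o2] at H
  unfold epsStarOP epsOP phiStarOP sigmaOP
  rw [← hw]
  linear_combination z ^ n * H
end

section
/- Let q ∈ (0,1), let V and W be nonzero complex polynomials, let w be a holomorphic nowhere-vanishing function on ℂ∖{0} with W(z) w(qz) = V(z) w(z) for all z ∈ ℂ∖{0}, let n ≥ 0 be an integer, and let A(z) be a 2×2 matrix of complex polynomials. Suppose Y is a function from the punctured open unit disk {z : 0 < |z| < 1} to 2×2 complex matrices such that V(z) Y(qz) = A(z) Y(z) for all z in the punctured disk, and det Y(z) = c · z^n / w(z) for some constant c ≠ 0 and all z in the punctured disk. Then det A(z) = q^n · V(z) · W(z) for all z ∈ ℂ. -/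
open Complex Matrix

/-- Determinant of the polynomial Lax matrix: if `V(z) Y(qz) = A(z) Y(z)` on the
punctured open unit disk, the entries of `A` are polynomials, `w` is holomorphic and
nowhere vanishing on `ℂ∖{0}` with `W(z) w(qz) = V(z) w(z)`, and
`det Y(z) = c zⁿ / w(z)` with `c ≠ 0`, then `det A(z) = qⁿ V(z) W(z)` for all `z ∈ ℂ`. -/
theorem det_lax_matrix
    (q : ℝ) (hq : q ∈ Set.Ioo (0 : ℝ) 1)
    (V W : Polynomial ℂ) (hV : V ≠ 0) (hW : W ≠ 0)
    (w : ℂ → ℂ)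
    (hw_hol : DifferentiableOn ℂ w {(0 : ℂ)}ᶜ)
    (hw_ne : ∀ z : ℂ, z ≠ 0 → w z ≠ 0)
    (hVW : ∀ z : ℂ, z ≠ 0 → W.eval z * w ((q : ℂ) * z) = V.eval z * w z)
    (n : ℕ)
    (A : ℂ → Matrix (Fin 2) (Fin 2) ℂ)
    (hApoly : ∀ i j : Fin 2, ∃ p : Polynomial ℂ, ∀ z : ℂ, A z i j = p.eval z)
    (Y : ℂ → Matrix (Fin 2) (Fin 2) ℂ)
    (hY : ∀ z : ℂ, 0 < ‖z‖ → ‖z‖ < 1 →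
      V.eval z • Y ((q : ℂ) * z) = A z * Y z)
    (c : ℂ) (hc : c ≠ 0)
    (hdet : ∀ z : ℂ, 0 < ‖z‖ → ‖z‖ < 1 →
      (Y z).det = c * z ^ n / w z) :
    ∀ z : ℂ, (A z).det = (q : ℂ) ^ n * V.eval z * W.eval z := by
  choose p hp using hApoly
  have key : p 0 0 * p 1 1 - p 0 1 * p 1 0 = Polynomial.C ((q : ℂ) ^ n) * V * W := by
    apply Polynomial.eq_of_infinite_eval_eq
    have hinf : (Metric.ball (0 : ℂ) 1 \ {0}).Infinite :=
      (infinite_of_mem_nhds (0 : ℂ) (Metric.ball_mem_nhds 0 one_pos)).diff (Set.finite_singleton 0)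
    refine hinf.mono ?_
    rintro z ⟨hz1, hz0⟩
    have hz1 : ‖z‖ < 1 := by simpa using hz1
    have hz0 : z ≠ 0 := by simpa using hz0
    have hzp : 0 < ‖z‖ := norm_pos_iff.mpr hz0
    have hq0 : (q : ℂ) ≠ 0 := by exact_mod_cast hq.1.ne'
    have hqz : (q : ℂ) * z ≠ 0 := mul_ne_zero hq0 hz0
    have hqz1 : ‖(q : ℂ) * z‖ < 1 := by
      rw [norm_mul, Complex.norm_real, Real.norm_of_nonneg hq.1.le]
      nlinarith [hq.1, hq.2]
    have h := congrArg Matrix.det (hY z hzp hz1)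
    rw [Matrix.det_smul, Matrix.det_mul, hdet z hzp hz1,
      hdet _ (norm_pos_iff.mpr hqz) hqz1, Fintype.card_fin] at h
    have hA : (A z).det = (q : ℂ) ^ n * V.eval z * W.eval z := by
      have h1 := hw_ne z hz0
      have h2 := hw_ne _ hqz
      have h3 := hVW z hz0
      have hzn : z ^ n ≠ 0 := pow_ne_zero n hz0
      rw [mul_pow, ← mul_div_assoc, ← mul_div_assoc, div_eq_div_iff h2 h1] at h
      apply mul_right_cancel₀ (mul_ne_zero (mul_ne_zero hc hzn) h2)
      linear_combination -h - V.eval z * (q : ℂ) ^ n * c * z ^ n * h3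
    rw [Matrix.det_fin_two, hp, hp, hp, hp] at hA
    simpa using hA
  intro z
  have h := congrArg (Polynomial.eval z) key
  rw [Matrix.det_fin_two, hp, hp, hp, hp]
  simpa using h
end

section
/- Assume n ≥ 1 and α_{n+1} ≠ 0. Then the unique polynomial Θ_n of degree at most 1 satisfying 2 α_{n+1} σ_n z^n Θ_n(z) = W(z) ε_n(qz) φ_n(z) - V(z) ε_n(z) φ_n(qz) for all 0 < |z| < 1 is given explicitly by Θ_n(z) = (b q^{n+1} - a) z + (conj(a) - conj(b) q^n) · α_n / α_{n+1}. -/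
open Complex MeasureTheory

/-- The `q`-Gamma weight
`w(z) = ∏_{i=0}^∞ (1 - a z q^i)(1 - conj(a) z⁻¹ q^i) / ∏_{i=0}^∞ (1 - b z q^i)(1 - conj(b) z⁻¹ q^i)`. -/
noncomputable def qGammaWeight (q : ℝ) (a b : ℂ) (z : ℂ) : ℂ :=
  ((∏' i : ℕ, (1 - a * z * (q : ℂ) ^ i)) *
      (∏' i : ℕ, (1 - (starRingEnd ℂ) a * z⁻¹ * (q : ℂ) ^ i))) /
    ((∏' i : ℕ, (1 - b * z * (q : ℂ) ^ i)) *
      (∏' i : ℕ, (1 - (starRingEnd ℂ) b * z⁻¹ * (q : ℂ) ^ i)))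

/-- `V(z) = (qz - conj a)(1 - bz)`. -/
noncomputable def Vq (q : ℝ) (a b : ℂ) (z : ℂ) : ℂ :=
  ((q : ℂ) * z - (starRingEnd ℂ) a) * (1 - b * z)

/-- `W(z) = (qz - conj b)(1 - az)`. -/
noncomputable def Wq (q : ℝ) (a b : ℂ) (z : ℂ) : ℂ :=
  ((q : ℂ) * z - (starRingEnd ℂ) b) * (1 - a * z)

/-- Integration against the measure `dμ(θ) = w(e^{iθ}) dθ` on `[0, 2π]`. -/
noncomputable def wInt (w : ℂ → ℂ) (f : ℝ → ℂ) : ℂ :=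
  ∫ θ in (0 : ℝ)..(2 * Real.pi), f θ * w (Complex.exp (θ * Complex.I))

/-- `σ_n = ∫ |φ_n|² dμ`, written as `∫ conj(φ_n) φ_n dμ`. -/
noncomputable def sigmaW (w : ℂ → ℂ) (φ : ℕ → Polynomial ℂ) (n : ℕ) : ℂ :=
  wInt w (fun θ => (starRingEnd ℂ) ((φ n).eval (Complex.exp (θ * Complex.I))) *
    (φ n).eval (Complex.exp (θ * Complex.I)))

/-- `ε_n(z) = ∫ (e^{iθ}+z)/(e^{iθ}-z) φ_n(e^{iθ}) dμ(θ)`. -/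
noncomputable def epsW (w : ℂ → ℂ) (φ : ℕ → Polynomial ℂ) (n : ℕ) (z : ℂ) : ℂ :=
  wInt w (fun θ => ((Complex.exp (θ * Complex.I) + z) / (Complex.exp (θ * Complex.I) - z)) *
    (φ n).eval (Complex.exp (θ * Complex.I)))

/-- `φ_n*(z) = z^n conj(φ_n(1/conj z))`, the reversed polynomial. -/
noncomputable def phiStarW (φ : ℕ → Polynomial ℂ) (n : ℕ) (z : ℂ) : ℂ :=
  z ^ n * (starRingEnd ℂ) ((φ n).eval ((starRingEnd ℂ) z)⁻¹)

/-! ### The infinite product `(x; q)_∞` -/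

noncomputable def qP (q : ℝ) (x : ℂ) : ℂ := ∏' i : ℕ, (1 - x * (q : ℂ) ^ i)

lemma qP_summable {q : ℝ} (hq : q ∈ Set.Ioo (0 : ℝ) 1) (x : ℂ) :
    Summable (fun i : ℕ => ‖-(x * (q : ℂ) ^ i)‖) := by
  have : Summable (fun i : ℕ => ‖x‖ * q ^ i) :=
    (summable_geometric_of_lt_one hq.1.le hq.2).mul_left _
  refine this.congr fun i => ?_
  simp [abs_of_pos hq.1]

lemma qP_mult {q : ℝ} (hq : q ∈ Set.Ioo (0 : ℝ) 1) (x : ℂ) :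
    Multipliable (fun i : ℕ => 1 - x * (q : ℂ) ^ i) := by
  simp_rw [sub_eq_add_neg]
  exact multipliable_one_add_of_summable (qP_summable hq x)

lemma qP_rec {q : ℝ} (hq : q ∈ Set.Ioo (0 : ℝ) 1) (x : ℂ) :
    qP q x = (1 - x) * qP q (q * x) := by
  unfold qP
  have h : ∀ i : ℕ, 1 - x * (q : ℂ) ^ (i + 1) = 1 - q * x * (q : ℂ) ^ i := fun i => by ring
  rw [tprod_eq_zero_mul']
  · simp [h]
  · simpa [h] using qP_mult hq (q * x)

lemma qP_ne {q : ℝ} (hq : q ∈ Set.Ioo (0 : ℝ) 1) {x : ℂ} (hx : ‖x‖ < 1) : qP q x ≠ 0 := by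
  unfold qP
  simp_rw [sub_eq_add_neg]
  refine tprod_one_add_ne_zero_of_summable (fun i h => ?_) (qP_summable hq x)
  have h1 : x * (q : ℂ) ^ i = 1 := by linear_combination -h
  have h2 : ‖x‖ * q ^ i = 1 := by
    have := congrArg norm h1
    simpa [abs_of_pos hq.1] using this
  have h3 : q ^ i ≤ 1 := pow_le_one₀ hq.1.le hq.2.le
  have h4 : 0 ≤ q ^ i := pow_nonneg hq.1.le i
  nlinarith [norm_nonneg x]

lemma qP_conj {q : ℝ} (hq : q ∈ Set.Ioo (0 : ℝ) 1) (x : ℂ) :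
    qP q ((starRingEnd ℂ) x) = (starRingEnd ℂ) (qP q x) := by
  unfold qP
  rw [(qP_mult hq x).map_tprod (starRingEnd ℂ) Complex.continuous_conj]
  simp

lemma qP_diff {q : ℝ} (hq : q ∈ Set.Ioo (0 : ℝ) 1) : Differentiable ℂ (qP q) := by
  intro x
  have hu : Summable (fun i : ℕ => (‖x‖ + 1) * q ^ i) :=
    (summable_geometric_of_lt_one hq.1.le hq.2).mul_left _
  have h := hu.hasProdLocallyUniformlyOn_nat_one_add (f := fun i x => -(x * (q : ℂ) ^ i))
    (Metric.isOpen_ball (x := (0 : ℂ)) (ε := ‖x‖ + 1)) (.of_forall fun i y hy => by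
      have : ‖y‖ < ‖x‖ + 1 := by simpa using hy
      have h4 : 0 ≤ q ^ i := pow_nonneg hq.1.le i
      simp only [norm_neg, norm_mul, norm_pow, Complex.norm_real, Real.norm_eq_abs,
        abs_of_pos hq.1]
      gcongr) (fun i => by fun_prop)
  have hd := h.differentiableOn (.of_forall fun s => by
    simpa [Finset.prod_fn] using
      DifferentiableOn.finsetProd (fun _ _ ↦ by fun_prop)) Metric.isOpen_ball
  have := hd.differentiableAt (Metric.isOpen_ball.mem_nhds (by simp : x ∈ Metric.ball (0 : ℂ) (‖x‖ + 1)))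
  have e : qP q = fun x => ∏' i : ℕ, (1 + -(x * (q : ℂ) ^ i)) := by
    funext y; simp only [qP, sub_eq_add_neg]
  rw [e]
  exact this

lemma weight_eq (q : ℝ) (a b z : ℂ) : qGammaWeight q a b z =
    (qP q (a * z) * qP q ((starRingEnd ℂ) a * z⁻¹)) /
      (qP q (b * z) * qP q ((starRingEnd ℂ) b * z⁻¹)) := rfl

lemma norm_e (θ : ℝ) : ‖Complex.exp (θ * Complex.I)‖ = 1 := Complex.norm_exp_ofReal_mul_I θ

lemma weight_pos {q : ℝ} (hq : q ∈ Set.Ioo (0 : ℝ) 1) {a b : ℂ}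
    (ha1 : ‖a‖ < 1) (hb1 : ‖b‖ < 1) {z : ℂ} (hz : ‖z‖ = 1) :
    ∃ r : ℝ, 0 < r ∧ qGammaWeight q a b z = r := by
  have hzi : z⁻¹ = (starRingEnd ℂ) z := Complex.inv_eq_conj hz
  refine ⟨Complex.normSq (qP q (a * z)) / Complex.normSq (qP q (b * z)), ?_, ?_⟩
  · have h1 : qP q (a * z) ≠ 0 := qP_ne hq (by simpa [hz])
    have h2 : qP q (b * z) ≠ 0 := qP_ne hq (by simpa [hz])
    exact div_pos (Complex.normSq_pos.2 h1) (Complex.normSq_pos.2 h2)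
  · rw [weight_eq, hzi, ← map_mul, ← map_mul, qP_conj hq, qP_conj hq, Complex.mul_conj,
      Complex.mul_conj]
    push_cast; rfl

lemma weight_cont {q : ℝ} (hq : q ∈ Set.Ioo (0 : ℝ) 1) {a b : ℂ} (hb1 : ‖b‖ < 1) :
    Continuous (fun θ : ℝ => qGammaWeight q a b (Complex.exp (θ * Complex.I))) := by
  simp only [weight_eq]
  have hc := (qP_diff hq).continuous
  have he : Continuous fun θ : ℝ => Complex.exp (θ * Complex.I) := by fun_prop
  have hi : Continuous fun θ : ℝ => (Complex.exp (θ * Complex.I))⁻¹ :=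
    he.inv₀ fun θ => Complex.exp_ne_zero _
  refine Continuous.div ?_ ?_ ?_
  · exact (hc.comp (continuous_const.mul he)).mul (hc.comp (continuous_const.mul hi))
  · exact (hc.comp (continuous_const.mul he)).mul (hc.comp (continuous_const.mul hi))
  · intro θ
    exact mul_ne_zero (qP_ne hq (by rw [norm_mul, norm_e, mul_one]; exact hb1)) (qP_ne hq (by rw [norm_mul, norm_inv, norm_e]; simpa using hb1))

/-- Integral over the unit circle. -/
noncomputable def J (w f : ℂ → ℂ) : ℂ :=
  ∫ θ in (0 : ℝ)..(2 * Real.pi), f (Complex.exp (θ * Complex.I)) * w (Complex.exp (θ * Complex.I))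

/-- Pearson identity. -/
lemma pearson {q : ℝ} (hq : q ∈ Set.Ioo (0 : ℝ) 1) {a b : ℂ} (hb1 : ‖b‖ < 1)
    (f : ℂ → ℂ) (hf : ∀ z, z ≠ 0 → DifferentiableAt ℂ f z) :
    J (qGammaWeight q a b) (fun z => f z * Vq q a b z) =
      J (qGammaWeight q a b) (fun z => f (z / q) * Wq q a b (z / q)) := by
  have hq0 : (q : ℂ) ≠ 0 := by exact_mod_cast hq.1.ne'
  let g : ℂ → ℂ := fun u => f (u / q) * (1 - a * (u / q)) * u *
    (qP q (a * u) * qP q ((starRingEnd ℂ) a * u⁻¹)) /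
      (qP q (b * u) * qP q (q * ((starRingEnd ℂ) b * u⁻¹)))
  have hd : ∀ z ∈ Metric.closedBall (0 : ℂ) 1 \ Metric.ball 0 q, DifferentiableAt ℂ g z := by
    rintro z ⟨hz1, hz2⟩
    simp at hz1 hz2
    have hz0 : z ≠ 0 := by
      rintro rfl
      simp at hz2; linarith [hq.1]
    have h1 : qP q (b * z) ≠ 0 := by
      apply qP_ne hq
      rw [norm_mul]; nlinarith [norm_nonneg b]
    have h2 : qP q (q * ((starRingEnd ℂ) b * z⁻¹)) ≠ 0 := by
      apply qP_ne hq
      have : ‖q * ((starRingEnd ℂ) b * z⁻¹)‖ = ‖b‖ * (q / ‖z‖) := by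
        simp [abs_of_pos hq.1]; ring
      rw [this]
      have : q / ‖z‖ ≤ 1 := (div_le_one (norm_pos_iff.2 hz0)).2 hz2
      have h3 : 0 ≤ q / ‖z‖ := div_nonneg hq.1.le (norm_nonneg z)
      nlinarith [norm_nonneg b]
    have hP := qP_diff hq
    have hi : DifferentiableAt ℂ (fun z : ℂ => z⁻¹) z := differentiableAt_inv hz0
    have hff : DifferentiableAt ℂ (fun z : ℂ => f (z / q)) z :=
      (hf (z / q) (div_ne_zero hz0 hq0)).comp z (differentiableAt_id.div_const _)
    refine DifferentiableAt.div ?_ ?_ (mul_ne_zero h1 h2)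
    · refine ((hff.mul (by fun_prop)).mul (by fun_prop)).mul (DifferentiableAt.mul ?_ ?_)
      · exact (hP _).comp z (by fun_prop)
      · exact (hP _).comp z (hi.const_mul _)
    · refine DifferentiableAt.mul ?_ ?_
      · exact (hP _).comp z (by fun_prop)
      · exact (hP _).comp z ((hi.const_mul _).const_mul _)
  have key := Complex.circleIntegral_sub_center_inv_smul_eq_of_differentiable_on_annulus_off_countable
    (c := 0) hq.1 hq.2.le (f := g) (s := ∅) Set.countable_empty
    (fun z hz => (hd z hz).continuousAt.continuousWithinAt)
    (fun z hz => hd z ⟨Metric.ball_subset_closedBall hz.1.1,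
      fun h => hz.1.2 (Metric.ball_subset_closedBall h)⟩)
  have hred : ∀ R : ℝ, R ≠ 0 → (∮ z in C(0, R), (z - 0)⁻¹ • g z) =
      Complex.I * ∫ θ in (0 : ℝ)..(2 * Real.pi), g (R * Complex.exp (θ * Complex.I)) := by
    intro R hR
    rw [circleIntegral, ← intervalIntegral.integral_const_mul]
    refine intervalIntegral.integral_congr fun θ _ => ?_
    have hR' : (R : ℂ) ≠ 0 := by exact_mod_cast hR
    have := Complex.exp_ne_zero (θ * Complex.I)
    simp [circleMap]
    field_simp
  rw [hred 1 one_ne_zero, hred q hq.1.ne'] at key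
  have key2 := mul_left_cancel₀ Complex.I_ne_zero key
  unfold J
  have hL : ∀ θ : ℝ, f (Complex.exp (θ * Complex.I)) * Vq q a b (Complex.exp (θ * Complex.I)) *
      qGammaWeight q a b (Complex.exp (θ * Complex.I)) = g (q * Complex.exp (θ * Complex.I)) := by
    intro θ
    have hz0 := Complex.exp_ne_zero (θ * Complex.I)
    have hz1 := norm_e θ
    generalize Complex.exp (θ * Complex.I) = z at hz0 hz1
    have e1 : (q : ℂ) * z / q = z := by field_simp
    have e2 : (q : ℂ) * ((starRingEnd ℂ) b * ((q : ℂ) * z)⁻¹) = (starRingEnd ℂ) b * z⁻¹ := by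
      field_simp
    have r1 := qP_rec hq (a * z)
    have r2 := qP_rec hq (b * z)
    have r3 := qP_rec hq ((starRingEnd ℂ) a * ((q : ℂ) * z)⁻¹)
    have e3 : (q : ℂ) * ((starRingEnd ℂ) a * ((q : ℂ) * z)⁻¹) = (starRingEnd ℂ) a * z⁻¹ := by
      field_simp
    have e4 : a * (q * z) = q * (a * z) := by ring
    have e5 : b * (q * z) = q * (b * z) := by ring
    have n1 : qP q (b * z) ≠ 0 := qP_ne hq (by simpa [hz1])
    have n2 : qP q ((starRingEnd ℂ) b * z⁻¹) ≠ 0 := qP_ne hq (by simpa [hz1])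
    have n3 : 1 - b * z ≠ 0 := by
      intro h; rw [r2, h] at n1; simp at n1
    have n4 : qP q (q * (b * z)) ≠ 0 := by
      intro h; rw [r2, h] at n1; simp at n1
    simp only [g]
    rw [weight_eq, e1, e2, r3, e3, e4, e5, r1, r2]
    have e0 : Vq q a b z = (1 - (starRingEnd ℂ) a * ((q : ℂ) * z)⁻¹) * (q * z) * (1 - b * z) := by
      unfold Vq
      field_simp
    rw [e0]
    generalize qP q (q * (b * z)) = X at *
    generalize qP q ((starRingEnd ℂ) b * z⁻¹) = X' at *
    generalize (1 - (starRingEnd ℂ) a * ((q : ℂ) * z)⁻¹) = Y at *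
    generalize (1 - b * z) = Z at *
    field_simp
  have hRR : ∀ θ : ℝ, f (Complex.exp (θ * Complex.I) / q) *
      Wq q a b (Complex.exp (θ * Complex.I) / q) *
      qGammaWeight q a b (Complex.exp (θ * Complex.I)) =
      g ((1 : ℝ) * Complex.exp (θ * Complex.I)) := by
    intro θ
    have hz0 := Complex.exp_ne_zero (θ * Complex.I)
    have hz1 := norm_e θ
    rw [Complex.ofReal_one, one_mul]
    generalize Complex.exp (θ * Complex.I) = z at hz0 hz1
    have r2 := qP_rec hq ((starRingEnd ℂ) b * z⁻¹)
    have n1 : qP q (b * z) ≠ 0 := qP_ne hq (by simpa [hz1])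
    have n2 : qP q ((starRingEnd ℂ) b * z⁻¹) ≠ 0 := qP_ne hq (by simpa [hz1])
    have n3 : 1 - (starRingEnd ℂ) b * z⁻¹ ≠ 0 := by
      intro h; rw [r2, h] at n2; simp at n2
    have n4 : qP q (q * ((starRingEnd ℂ) b * z⁻¹)) ≠ 0 := by
      intro h; rw [r2, h] at n2; simp at n2
    have n5 : z - (starRingEnd ℂ) b ≠ 0 := by
      intro h; apply n3; field_simp; rw [h, mul_zero]
    have e0 : Wq q a b (z / q) = z * (1 - (starRingEnd ℂ) b * z⁻¹) * (1 - a * (z / q)) := by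
      unfold Wq
      field_simp
    simp only [g]
    rw [weight_eq, e0, r2]
    generalize qP q (q * ((starRingEnd ℂ) b * z⁻¹)) = X at *
    generalize (1 - (starRingEnd ℂ) b * z⁻¹) = Y at *
    generalize (1 - a * (z / q)) = Z at *
    generalize f (z / q) = F at *
    field_simp
  simp only [hL, hRR]
  exact key2.symm

/-! ### Generalised moments -/

open Polynomial in
/-- `∫ u^k p(u) dμ`. -/
noncomputable def cc (w : ℂ → ℂ) (p : ℂ[X]) (k : ℤ) : ℂ := J w (fun u => u ^ k * p.eval u)

lemma cont_zpow (k : ℤ) : Continuous fun θ : ℝ => (Complex.exp (θ * Complex.I)) ^ k := by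
  have he : Continuous fun θ : ℝ => Complex.exp (θ * Complex.I) := by fun_prop
  exact he.zpow₀ k fun θ => Or.inl (Complex.exp_ne_zero _)

lemma cont_poly (p : Polynomial ℂ) :
    Continuous fun θ : ℝ => p.eval (Complex.exp (θ * Complex.I)) := by
  have he : Continuous fun θ : ℝ => Complex.exp (θ * Complex.I) := by fun_prop
  exact p.continuous.comp he

lemma cont_term (c : ℂ) (k : ℤ) (p : Polynomial ℂ) :
    Continuous fun θ : ℝ => c * ((Complex.exp (θ * Complex.I)) ^ k *
      p.eval (Complex.exp (θ * Complex.I))) :=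
  continuous_const.mul ((cont_zpow k).mul (cont_poly p))

lemma J_congr (w : ℂ → ℂ) {f g : ℂ → ℂ} (h : ∀ u, ‖u‖ = 1 → f u = g u) : J w f = J w g := by
  unfold J
  exact intervalIntegral.integral_congr fun θ _ => by simp only [h _ (norm_e θ)]

lemma J_add {w f g : ℂ → ℂ} (hw : Continuous fun θ : ℝ => w (Complex.exp (θ * Complex.I)))
    (hf : Continuous fun θ : ℝ => f (Complex.exp (θ * Complex.I)))
    (hg : Continuous fun θ : ℝ => g (Complex.exp (θ * Complex.I))) :
    J w (fun u => f u + g u) = J w f + J w g := by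
  unfold J
  rw [← intervalIntegral.integral_add]
  · simp only [add_mul]
  · exact (hf.mul hw).intervalIntegrable _ _
  · exact (hg.mul hw).intervalIntegrable _ _

lemma J_const_mul (w f : ℂ → ℂ) (c : ℂ) : J w (fun u => c * f u) = c * J w f := by
  unfold J
  rw [← intervalIntegral.integral_const_mul]
  simp only [mul_assoc]

lemma J_sum {w : ℂ → ℂ} (hw : Continuous fun θ : ℝ => w (Complex.exp (θ * Complex.I)))
    (p : Polynomial ℂ) (s : Finset ℕ) (C : ℕ → ℂ) (k : ℕ → ℤ) :
    J w (fun u => ∑ i ∈ s, C i * (u ^ (k i) * p.eval u)) = ∑ i ∈ s, C i * cc w p (k i) := by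
  unfold cc
  simp only [← J_const_mul]
  unfold J
  rw [← intervalIntegral.integral_finsetSum]
  · simp only [Finset.sum_mul]
  · intro i _
    exact ((continuous_const.mul ((cont_zpow _).mul (cont_poly p))).mul hw).intervalIntegrable _ _

lemma J_poly {w : ℂ → ℂ} (hw : Continuous fun θ : ℝ => w (Complex.exp (θ * Complex.I)))
    (p P : Polynomial ℂ) (N : ℕ) (hP : P.natDegree < N) (m : ℤ) :
    J w (fun u => u ^ m * P.eval u * p.eval u) =
      ∑ j ∈ Finset.range N, P.coeff j * cc w p (m + j) := by
  rw [← J_sum hw]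
  refine J_congr w fun u hu => ?_
  have hu0 : u ≠ 0 := by rintro rfl; simp at hu
  rw [Polynomial.eval_eq_sum_range' hP, Finset.mul_sum, Finset.sum_mul]
  refine Finset.sum_congr rfl fun j _ => ?_
  rw [zpow_add₀ hu0, zpow_natCast]
  ring

lemma cc_sub {w : ℂ → ℂ} (hw : Continuous fun θ : ℝ => w (Complex.exp (θ * Complex.I)))
    (p r : Polynomial ℂ) (k : ℤ) :
    cc w (p - Polynomial.X * r) k = cc w p k - cc w r (k + 1) := by
  have h : cc w p k - cc w r (k + 1) = cc w p k + (-1) * cc w r (k + 1) := by ring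
  rw [h]
  unfold cc
  rw [← J_const_mul, ← J_add (f := fun u => u ^ k * p.eval u)
    (g := fun u => -1 * (u ^ (k + 1) * r.eval u)) hw ((cont_zpow _).mul (cont_poly p))
    (cont_term _ _ _)]
  refine J_congr w fun u hu => ?_
  have hu0 : u ≠ 0 := by rintro rfl; simp at hu
  simp only [Polynomial.eval_sub, Polynomial.eval_mul, Polynomial.eval_X]
  rw [zpow_add₀ hu0, zpow_one]
  ring

lemma orth_cc {w : ℂ → ℂ} {p : Polynomial ℂ} {k : ℕ}
    (h : wInt w (fun θ => p.eval (Complex.exp (θ * Complex.I)) *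
        Complex.exp (-(k : ℂ) * θ * Complex.I)) = 0) : cc w p (-(k : ℤ)) = 0 := by
  rw [← h]
  unfold cc J wInt
  refine intervalIntegral.integral_congr fun θ _ => ?_
  have : Complex.exp (-(k : ℂ) * θ * Complex.I) = (Complex.exp (θ * Complex.I)) ^ (-(k : ℤ)) := by
    rw [← Complex.exp_int_mul]; push_cast; ring_nf
  simp only [this]
  ring

lemma sigma_cc {w : ℂ → ℂ} (hw : Continuous fun θ : ℝ => w (Complex.exp (θ * Complex.I)))
    {φ : ℕ → Polynomial ℂ} (hmonic : ∀ n, (φ n).Monic) (hdeg : ∀ n, (φ n).natDegree = n)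
    (n : ℕ) (ho : ∀ k < n, cc w (φ n) (-(k : ℤ)) = 0) :
    sigmaW w φ n = cc w (φ n) (-(n : ℤ)) := by
  have h1 : sigmaW w φ n = J w (fun u => ∑ j ∈ Finset.range (n + 1),
      (starRingEnd ℂ) ((φ n).coeff j) * (u ^ (-(j : ℤ)) * (φ n).eval u)) := by
    have : sigmaW w φ n = J w (fun u => (starRingEnd ℂ) ((φ n).eval u) * (φ n).eval u) := rfl
    rw [this]
    refine J_congr w fun u hu => ?_
    have hu' : (starRingEnd ℂ) u = u⁻¹ := (Complex.inv_eq_conj hu).symm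
    have e : (starRingEnd ℂ) ((φ n).eval u) = ∑ j ∈ Finset.range (n + 1),
        (starRingEnd ℂ) ((φ n).coeff j) * u ^ (-(j : ℤ)) := by
      rw [Polynomial.eval_eq_sum_range' (n := n + 1) (by rw [hdeg]; omega), map_sum]
      refine Finset.sum_congr rfl fun j _ => ?_
      rw [map_mul, map_pow, hu', zpow_neg, zpow_natCast, inv_pow]
    rw [e, Finset.sum_mul]
    exact Finset.sum_congr rfl fun j _ => by ring
  rw [h1, J_sum hw, Finset.sum_range_succ, Finset.sum_eq_zero]
  · have : (φ n).coeff n = 1 := by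
      have := (hmonic n).coeff_natDegree
      rwa [hdeg] at this
    simp [this]
  · intro j hj
    rw [ho j (Finset.mem_range.1 hj), mul_zero]

/-- The consequence of the Szegő recurrence. -/
lemma szego {w : ℂ → ℂ} (hw : Continuous fun θ : ℝ => w (Complex.exp (θ * Complex.I)))
    {φ : ℕ → Polynomial ℂ} (hmonic : ∀ n, (φ n).Monic) (hdeg : ∀ n, (φ n).natDegree = n)
    (ho : ∀ n, ∀ k < n, cc w (φ n) (-(k : ℤ)) = 0) (n : ℕ) :
    cc w (φ n) 1 = -((φ (n + 1)).eval 0) * cc w (φ n) (-(n : ℤ)) := by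
  set R := φ (n + 1) - Polynomial.X * φ n with hR
  have hc : ∀ m, (φ m).coeff m = 1 := fun m => by
    have := (hmonic m).coeff_natDegree
    rwa [hdeg] at this
  have hRd : R.natDegree < n + 1 := by
    have h0 : R.natDegree ≤ n := by
      rw [Polynomial.natDegree_le_iff_coeff_eq_zero]
      intro N hN
      obtain ⟨M, rfl⟩ : ∃ M, N = M + 1 := ⟨N - 1, by omega⟩
      rw [hR, Polynomial.coeff_sub, Polynomial.coeff_X_mul]
      rcases Nat.lt_or_ge n M with h | h
      · rw [Polynomial.coeff_eq_zero_of_natDegree_lt (by rw [hdeg]; omega),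
          Polynomial.coeff_eq_zero_of_natDegree_lt (by rw [hdeg]; omega), sub_zero]
      · have : M = n := by omega
        subst this
        rw [hc, hc, sub_self]
    omega
  have hR0 : R.coeff 0 = (φ (n + 1)).eval 0 := by
    simp [hR, Polynomial.coeff_zero_eq_eval_zero]
  have e1 := J_poly hw (φ n) R (n + 1) hRd (-(n : ℤ))
  have e2 := J_poly hw R (φ n) (n + 1) (by rw [hdeg]; omega) (-(n : ℤ))
  have e3 : J w (fun u => u ^ (-(n : ℤ)) * R.eval u * (φ n).eval u) =
      J w (fun u => u ^ (-(n : ℤ)) * (φ n).eval u * R.eval u) :=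
    J_congr w fun u _ => by ring
  rw [Finset.sum_range_succ', Finset.sum_eq_zero] at e1
  · rw [Finset.sum_range_succ, Finset.sum_eq_zero] at e2
    · rw [e3, e2, hR0, hc] at e1
      have e4 := cc_sub hw (φ (n + 1)) (φ n) 0
      have e5 := ho (n + 1) 0 (by omega)
      rw [← hR] at e4
      simp at e1 e4 e5
      rw [e5, e1] at e4
      rw [neg_mul, e4]
      ring
    · intro j hj
      have hj' := Finset.mem_range.1 hj
      have e4 := cc_sub hw (φ (n + 1)) (φ n) (-(n : ℤ) + j)
      have i1 : -(n : ℤ) + j = -((n - j : ℕ) : ℤ) := by omega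
      have i2 : -(n : ℤ) + j + 1 = -((n - j - 1 : ℕ) : ℤ) := by omega
      rw [i2, i1, ho _ _ (by omega), ho _ _ (by omega)] at e4
      rw [i1, hR, e4]
      ring
  · intro j hj
    have hj' := Finset.mem_range.1 hj
    have i1 : -(n : ℤ) + (j + 1 : ℕ) = -((n - (j + 1) : ℕ) : ℤ) := by omega
    rw [i1, ho _ _ (by omega), mul_zero]

lemma sigma_ne {q : ℝ} (hq : q ∈ Set.Ioo (0 : ℝ) 1) {a b : ℂ}
    (ha1 : ‖a‖ < 1) (hb1 : ‖b‖ < 1) (φ : ℕ → Polynomial ℂ) (n : ℕ) (hφ : φ n ≠ 0) :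
    sigmaW (qGammaWeight q a b) φ n ≠ 0 := by
  let e : ℝ → ℂ := fun θ => Complex.exp (θ * Complex.I)
  choose! r hr0 hr using fun z (hz : ‖z‖ = 1) => weight_pos hq ha1 hb1 hz
  have hrc : Continuous fun θ => r (e θ) := by
    have : (fun θ => r (e θ)) = fun θ => (qGammaWeight q a b (e θ)).re := by
      funext θ
      rw [hr _ (norm_e θ), Complex.ofReal_re]
    rw [this]
    exact Complex.continuous_re.comp (weight_cont hq hb1)
  have h1 : sigmaW (qGammaWeight q a b) φ n =
      ((∫ θ in (0 : ℝ)..(2 * Real.pi), Complex.normSq ((φ n).eval (e θ)) * r (e θ) : ℝ) : ℂ) := by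
    rw [← intervalIntegral.integral_ofReal]
    refine intervalIntegral.integral_congr fun θ _ => ?_
    simp only [e]
    rw [hr _ (norm_e θ), mul_comm ((starRingEnd ℂ) _), Complex.mul_conj]
    push_cast; rfl
  rw [h1]
  have hex : ∃ θ ∈ Set.Icc (0 : ℝ) Real.pi, (φ n).eval (e θ) ≠ 0 := by
    by_contra hcon
    push Not at hcon
    apply hφ
    apply Polynomial.eq_zero_of_infinite_isRoot
    have hinf : (e '' Set.Icc (0 : ℝ) Real.pi).Infinite := by
      refine Set.Infinite.image ?_ (Set.Icc_infinite Real.pi_pos)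
      intro x hx y hy hxy
      apply Real.injOn_cos hx hy
      have := congrArg Complex.re hxy
      simpa [e, Complex.exp_ofReal_mul_I_re] using this
    refine hinf.mono ?_
    rintro _ ⟨θ, hθ, rfl⟩
    exact hcon θ hθ
  obtain ⟨θ, hθ, hne⟩ := hex
  have hpos : 0 < ∫ θ in (0 : ℝ)..(2 * Real.pi), Complex.normSq ((φ n).eval (e θ)) * r (e θ) := by
    refine intervalIntegral.integral_pos (by positivity) ?_ ?_ ?_
    · exact ((Complex.continuous_normSq.comp (cont_poly (φ n))).mul hrc).continuousOn
    · intro x _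
      exact mul_nonneg (Complex.normSq_nonneg _) (hr0 _ (norm_e x)).le
    · exact ⟨θ, ⟨hθ.1, by linarith [hθ.2, Real.pi_pos]⟩,
        mul_pos (Complex.normSq_pos.2 hne) (hr0 _ (norm_e θ))⟩
  exact_mod_cast hpos.ne'

/-- Remainder term. -/
noncomputable def rho (w : ℂ → ℂ) (p : Polynomial ℂ) (n : ℕ) (z : ℂ) : ℂ :=
  J w (fun u => u ^ (-((n : ℤ) + 1)) * p.eval u / (u - z))

lemma eps_expand {w : ℂ → ℂ} (hw : Continuous fun θ : ℝ => w (Complex.exp (θ * Complex.I)))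
    {φ : ℕ → Polynomial ℂ} (n : ℕ) (hn : 1 ≤ n)
    (ho : ∀ k < n, cc w (φ n) (-(k : ℤ)) = 0) (z : ℂ) (hz : ‖z‖ < 1) :
    epsW w φ n z = 2 * z ^ n * (cc w (φ n) (-(n : ℤ)) + cc w (φ n) (-((n : ℤ) + 1)) * z +
      z * (z * rho w (φ n) n z)) := by
  have hne : ∀ u : ℂ, ‖u‖ = 1 → u - z ≠ 0 := fun u hu h => by
    rw [sub_eq_zero.1 h] at hu; linarith
  have hc : Continuous fun θ : ℝ => (Complex.exp (θ * Complex.I)) ^ (-((n : ℤ) + 1)) *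
      (φ n).eval (Complex.exp (θ * Complex.I)) / (Complex.exp (θ * Complex.I) - z) :=
    ((cont_zpow _).mul (cont_poly _)).div (by fun_prop) fun θ => hne _ (norm_e θ)
  have h1 : epsW w φ n z = J w (fun u => (-1) * (u ^ (0 : ℤ) * (φ n).eval u) +
      ((∑ k ∈ Finset.range (n + 2), (2 * z ^ k) * (u ^ (-(k : ℤ)) * (φ n).eval u)) +
      (2 * z ^ (n + 2)) * (u ^ (-((n : ℤ) + 1)) * (φ n).eval u / (u - z)))) := by
    have : epsW w φ n z = J w (fun u => (u + z) / (u - z) * (φ n).eval u) := rfl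
    rw [this]
    refine J_congr w fun u hu => ?_
    have hu0 : u ≠ 0 := by rintro rfl; simp at hu
    have huz := hne u hu
    have hg : ∑ k ∈ Finset.range (n + 2), (2 * z ^ k) * (u ^ (-(k : ℤ)) * (φ n).eval u) =
        2 * (φ n).eval u * ∑ k ∈ Finset.range (n + 2), (z / u) ^ k := by
      rw [Finset.mul_sum]
      refine Finset.sum_congr rfl fun k _ => ?_
      rw [zpow_neg, zpow_natCast, div_pow]
      ring
    have ht : z / u ≠ 1 := by
      intro h
      rw [div_eq_one_iff_eq hu0] at h
      exact huz (by rw [h, sub_self])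
    have ht' : z / u - 1 ≠ 0 := sub_ne_zero.2 ht
    have ht2 : z - u ≠ 0 := fun h => huz (by rw [← neg_sub, h, neg_zero])
    have e1 : u ^ (-((n : ℤ) + 1)) = (u ^ (n + 1))⁻¹ := by
      rw [zpow_neg]; norm_cast
    rw [hg, geom_sum_eq ht, e1, div_pow]
    have e2 : z / u - 1 = -(u - z) / u := by field_simp; ring
    rw [e2]
    field_simp
    ring
  rw [h1, J_add (f := fun u => (-1) * (u ^ (0 : ℤ) * (φ n).eval u)) hw (cont_term _ _ _), J_add hw,
    J_const_mul, J_const_mul, J_sum hw]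
  · have e0 : J w (fun u => u ^ (0 : ℤ) * (φ n).eval u) = 0 := by
      have := ho 0 (by omega)
      simpa [cc] using this
    rw [e0, Finset.sum_range_succ, Finset.sum_range_succ, Finset.sum_eq_zero]
    · unfold rho
      push_cast
      ring
    · intro k hk
      rw [ho k (Finset.mem_range.1 hk), mul_zero]
  · exact continuous_finsetSum _ fun k _ =>
      continuous_const.mul ((cont_zpow _).mul (cont_poly _))
  · exact continuous_const.mul hc
  · exact (continuous_finsetSum _ fun k _ =>
      continuous_const.mul ((cont_zpow _).mul (cont_poly _))).add (continuous_const.mul hc)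

lemma rho_bdd {w : ℂ → ℂ} (hw : Continuous fun θ : ℝ => w (Complex.exp (θ * Complex.I)))
    (p : Polynomial ℂ) (n : ℕ) : ∃ K : ℝ, ∀ z : ℂ, ‖z‖ < 1 / 2 → ‖rho w p n z‖ ≤ K := by
  have hc := ((cont_zpow (-((n : ℤ) + 1))).mul (cont_poly p)).mul hw
  obtain ⟨M, hM⟩ := isCompact_Icc.exists_bound_of_continuousOn
    (s := Set.Icc (0 : ℝ) (2 * Real.pi)) hc.continuousOn
  refine ⟨(2 * M) * |2 * Real.pi - 0|, fun z hz => ?_⟩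
  unfold rho J
  refine intervalIntegral.norm_integral_le_of_norm_le_const fun θ hθ => ?_
  rw [Set.uIoc_of_le (by positivity)] at hθ
  have h1 := hM θ ⟨hθ.1.le, hθ.2⟩
  have h2 : 1 / 2 ≤ ‖Complex.exp (θ * Complex.I) - z‖ := by
    have := norm_sub_norm_le (Complex.exp (θ * Complex.I)) z
    rw [norm_e] at this
    linarith
  rw [div_mul_eq_mul_div, norm_div, div_le_iff₀ (by linarith)]
  simp only [Pi.mul_apply] at h1
  nlinarith [norm_nonneg (Complex.exp (θ * Complex.I) ^ (-((n : ℤ) + 1)) *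
    Polynomial.eval (Complex.exp (θ * Complex.I)) p * w (Complex.exp (θ * Complex.I)))]

open Filter Topology in
lemma coeff_match (P Q : Polynomial ℂ) (A0 A1 B0 B1 T0 T1 : ℂ) (s1 s2 : ℂ → ℂ)
    (h1 : Tendsto s1 (𝓝[≠] 0) (𝓝 0)) (h2 : Tendsto s2 (𝓝[≠] 0) (𝓝 0))
    (h : ∀ᶠ z in 𝓝[≠] (0 : ℂ), P.eval z * (A0 + A1 * z + z * s1 z) -
      Q.eval z * (B0 + B1 * z + z * s2 z) = T0 + T1 * z) :
    P.coeff 0 * A0 - Q.coeff 0 * B0 = T0 ∧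
      P.coeff 1 * A0 + P.coeff 0 * A1 - (Q.coeff 1 * B0 + Q.coeff 0 * B1) = T1 := by
  have hz : Tendsto (fun z : ℂ => z) (𝓝[≠] 0) (𝓝 0) := tendsto_nhdsWithin_of_tendsto_nhds tendsto_id
  have hp : ∀ p : Polynomial ℂ, Tendsto (fun z : ℂ => p.eval z) (𝓝[≠] 0) (𝓝 (p.coeff 0)) := by
    intro p
    rw [Polynomial.coeff_zero_eq_eval_zero]
    exact (p.continuous.tendsto 0).comp hz
  have hA : Tendsto (fun z => A0 + A1 * z + z * s1 z) (𝓝[≠] 0) (𝓝 A0) := by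
    simpa using (tendsto_const_nhds (x := A0)).add (hz.const_mul A1) |>.add (hz.mul h1)
  have hB : Tendsto (fun z => B0 + B1 * z + z * s2 z) (𝓝[≠] 0) (𝓝 B0) := by
    simpa using (tendsto_const_nhds (x := B0)).add (hz.const_mul B1) |>.add (hz.mul h2)
  have hT : Tendsto (fun z => T0 + T1 * z) (𝓝[≠] 0) (𝓝 T0) := by
    simpa using (tendsto_const_nhds (x := T0)).add (hz.const_mul T1)
  have r0 : P.coeff 0 * A0 - Q.coeff 0 * B0 = T0 :=
    tendsto_nhds_unique_of_eventuallyEq (((hp P).mul hA).sub ((hp Q).mul hB)) hT h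
  refine ⟨r0, ?_⟩
  have hA' : Tendsto (fun z => A1 + s1 z) (𝓝[≠] 0) (𝓝 A1) := by
    simpa using (tendsto_const_nhds (x := A1)).add h1
  have hB' : Tendsto (fun z => B1 + s2 z) (𝓝[≠] 0) (𝓝 B1) := by
    simpa using (tendsto_const_nhds (x := B1)).add h2
  have hl := (((hp P.divX).mul hA).add (hA'.const_mul (P.coeff 0))).sub
    (((hp Q.divX).mul hB).add (hB'.const_mul (Q.coeff 0)))
  rw [Polynomial.coeff_divX, Polynomial.coeff_divX] at hl
  refine tendsto_nhds_unique_of_eventuallyEq hl (tendsto_const_nhds (x := T1)) ?_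
  filter_upwards [h, self_mem_nhdsWithin] with z hz hz0
  have hz0' : z ≠ 0 := hz0
  have ev : ∀ p : Polynomial ℂ, p.eval z = z * p.divX.eval z + p.coeff 0 := fun p => by
    have := congrArg (Polynomial.eval z) p.X_mul_divX_add
    rw [Polynomial.eval_add, Polynomial.eval_mul, Polynomial.eval_X, Polynomial.eval_C] at this
    exact this.symm
  rw [ev P, ev Q] at hz
  apply mul_left_cancel₀ hz0'
  linear_combination hz - r0

lemma collapse {w : ℂ → ℂ} {φ : ℕ → Polynomial ℂ} (n : ℕ)
    (ho : ∀ k < n, cc w (φ n) (-(k : ℤ)) = 0) (C : ℕ → ℂ) :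
    ∑ j ∈ Finset.range (n + 3), C j * cc w (φ n) (-((n : ℤ) + 1) + j) =
      C 0 * cc w (φ n) (-((n : ℤ) + 1)) + C 1 * cc w (φ n) (-(n : ℤ)) +
      C (n + 2) * cc w (φ n) 1 := by
  rw [Finset.sum_range_succ, Finset.sum_range_succ', Finset.sum_range_succ', Finset.sum_eq_zero]
  · have i1 : -((n : ℤ) + 1) + (0 + 1 : ℕ) = -(n : ℤ) := by push_cast; ring
    have i2 : -((n : ℤ) + 1) + (n + 2 : ℕ) = 1 := by push_cast; ring
    have i3 : -((n : ℤ) + 1) + (0 : ℕ) = -((n : ℤ) + 1) := by push_cast; ring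
    rw [i1, i2, i3]
    ring
  · intro j hj
    have hj' := Finset.mem_range.1 hj
    have i1 : -((n : ℤ) + 1) + (j + 1 + 1 : ℕ) = -((n - (j + 1) : ℕ) : ℤ) := by omega
    rw [i1, ho _ (by omega), mul_zero]

lemma coef_top (q : ℝ) (c d : ℂ) :
    ((Polynomial.C (q : ℂ) * Polynomial.X - Polynomial.C c) *
      (1 - Polynomial.C d * Polynomial.X)).natDegree ≤ 2 ∧
    ((Polynomial.C (q : ℂ) * Polynomial.X - Polynomial.C c) *
      (1 - Polynomial.C d * Polynomial.X)).coeff 2 = -(q * d) := by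
  have h1 : (Polynomial.C (q : ℂ) * Polynomial.X - Polynomial.C c).natDegree ≤ 1 := by
    compute_degree
  have h2 : (1 - Polynomial.C d * Polynomial.X).natDegree ≤ 1 := by compute_degree
  refine ⟨Polynomial.natDegree_mul_le_of_le h1 h2, ?_⟩
  have := Polynomial.coeff_mul_add_eq_of_natDegree_le h1 h2
  rw [show (2 : ℕ) = 1 + 1 from rfl, this]
  simp [Polynomial.coeff_C, Polynomial.coeff_one]

/-- For the `q`-Gamma weight, the unique polynomial `Θ_n` of degree at most 1 with
`2 α_{n+1} σ_n z^n Θ_n(z) = W(z) ε_n(qz) φ_n(z) - V(z) ε_n(z) φ_n(qz)` on `0 < |z| < 1`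
is `Θ_n(z) = (b q^{n+1} - a) z + (conj a - conj b qⁿ) α_n / α_{n+1}`. -/
theorem Theta_explicit
    (q : ℝ) (hq : q ∈ Set.Ioo (0 : ℝ) 1)
    (a b : ℂ) (ha : a ≠ 0) (hb : b ≠ 0)
    (ha1 : ‖a‖ < 1) (hb1 : ‖b‖ < 1)
    (φ : ℕ → Polynomial ℂ)
    (hmonic : ∀ n, (φ n).Monic)
    (hdeg : ∀ n, (φ n).natDegree = n)
    (horth : ∀ n, ∀ k < n, wInt (qGammaWeight q a b) (fun θ =>
      (φ n).eval (Complex.exp (θ * Complex.I)) *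
        Complex.exp (-(k : ℂ) * θ * Complex.I)) = 0)
    (n : ℕ) (hn : 1 ≤ n) (hα : (φ (n + 1)).eval 0 ≠ 0)
    (Θ : Polynomial ℂ) (hΘdeg : Θ.natDegree ≤ 1)
    (hΘeq : ∀ z : ℂ, 0 < ‖z‖ → ‖z‖ < 1 →
      2 * (φ (n + 1)).eval 0 * sigmaW (qGammaWeight q a b) φ n * z ^ n * Θ.eval z
        = Wq q a b z * epsW (qGammaWeight q a b) φ n ((q : ℂ) * z) * (φ n).eval z
          - Vq q a b z * epsW (qGammaWeight q a b) φ n z * (φ n).eval ((q : ℂ) * z)) :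
    ∀ z : ℂ, Θ.eval z
      = (b * (q : ℂ) ^ (n + 1) - a) * z
        + ((starRingEnd ℂ) a - (starRingEnd ℂ) b * (q : ℂ) ^ n) *
            ((φ n).eval 0 / (φ (n + 1)).eval 0) := by
  have hq0 : (q : ℂ) ≠ 0 := by exact_mod_cast hq.1.ne'
  have hw := weight_cont hq (a := a) hb1
  set w := qGammaWeight q a b with hwdef
  have ho : ∀ n, ∀ k < n, cc w (φ n) (-(k : ℤ)) = 0 := fun n k hk => orth_cc (horth n k hk)
  have hσ : sigmaW w φ n = cc w (φ n) (-(n : ℤ)) := sigma_cc hw hmonic hdeg n (ho n)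
  have hσ0 : cc w (φ n) (-(n : ℤ)) ≠ 0 := hσ ▸ sigma_ne hq ha1 hb1 φ n (hmonic n).ne_zero
  have hS := szego hw hmonic hdeg ho n
  set α := (φ (n + 1)).eval 0 with hαdef
  set c0 := cc w (φ n) (-(n : ℤ)) with hc0
  set c1 := cc w (φ n) (-((n : ℤ) + 1)) with hc1
  set WW : Polynomial ℂ := (Polynomial.C (q : ℂ) * Polynomial.X -
    Polynomial.C ((starRingEnd ℂ) b)) * (1 - Polynomial.C a * Polynomial.X) with hWW
  set VV : Polynomial ℂ := (Polynomial.C (q : ℂ) * Polynomial.X -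
    Polynomial.C ((starRingEnd ℂ) a)) * (1 - Polynomial.C b * Polynomial.X) with hVV
  obtain ⟨dW, tW⟩ := coef_top q ((starRingEnd ℂ) b) a
  obtain ⟨dV, tV⟩ := coef_top q ((starRingEnd ℂ) a) b
  rw [← hWW] at dW tW
  rw [← hVV] at dV tV
  have eW : ∀ z, WW.eval z = Wq q a b z := fun z => by simp [hWW, Wq]
  have eV : ∀ z, VV.eval z = Vq q a b z := fun z => by simp [hVV, Vq]
  set P := WW * φ n with hP
  set φq := (φ n).comp (Polynomial.C (q : ℂ) * Polynomial.X) with hφq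
  set Q := VV * φq with hQ
  have eφq : ∀ z, φq.eval z = (φ n).eval (q * z) := fun z => by simp [hφq]
  have dφq : φq.natDegree ≤ n := by
    rw [Polynomial.natDegree_le_iff_coeff_eq_zero]
    intro N hN
    rw [hφq, Polynomial.comp_C_mul_X_coeff,
      Polynomial.coeff_eq_zero_of_natDegree_lt (by rw [hdeg]; exact hN), zero_mul]
  have hcn : (φ n).coeff n = 1 := by
    have := (hmonic n).coeff_natDegree
    rwa [hdeg] at this
  have tP : P.coeff (n + 2) = -(q * a) := by
    rw [add_comm, hP, Polynomial.coeff_mul_add_eq_of_natDegree_le dW (hdeg n).le, tW, hcn, mul_one]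
  have tQ : Q.coeff (n + 2) = -(q * b) * q ^ n := by
    rw [add_comm, hQ, Polynomial.coeff_mul_add_eq_of_natDegree_le dV dφq, tV, hφq,
      Polynomial.comp_C_mul_X_coeff, hcn, one_mul]
  have dP : P.natDegree < n + 3 := by
    have := Polynomial.natDegree_mul_le_of_le dW (hdeg n).le
    rw [← hP] at this; omega
  have dQ : Q.natDegree < n + 3 := by
    have := Polynomial.natDegree_mul_le_of_le dV dφq
    rw [← hQ] at this; omega
  have P0 : P.coeff 0 = -(starRingEnd ℂ) b * (φ n).eval 0 := by
    rw [Polynomial.coeff_zero_eq_eval_zero, hP, Polynomial.eval_mul, eW]; simp [Wq]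
  have Q0 : Q.coeff 0 = -(starRingEnd ℂ) a * (φ n).eval 0 := by
    rw [Polynomial.coeff_zero_eq_eval_zero, hQ, Polynomial.eval_mul, eV, eφq]; simp [Vq]
  -- Pearson
  have hpear : Q.coeff 0 * c1 + Q.coeff 1 * c0 + Q.coeff (n + 2) * cc w (φ n) 1 =
      (q : ℂ) ^ (n + 1) * (P.coeff 0 * c1 + P.coeff 1 * (q : ℂ)⁻¹ * c0 +
        P.coeff (n + 2) * ((q : ℂ)⁻¹) ^ (n + 2) * cc w (φ n) 1) := by
    have h := pearson hq (a := a) hb1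
      (fun z => z ^ (-((n : ℤ) + 1)) * (φ n).eval (q * z) * (φ n).eval z) (fun z hz => by
        have h1 : DifferentiableAt ℂ (fun z : ℂ => z ^ (-((n : ℤ) + 1))) z :=
          differentiableAt_zpow.2 (Or.inl hz)
        have h2 : DifferentiableAt ℂ (fun z : ℂ => (φ n).eval (q * z)) z := by
          simp only [← eφq]; exact φq.differentiableAt
        exact (h1.mul h2).mul (φ n).differentiableAt)
    rw [← hwdef] at h
    set P' := P.comp (Polynomial.C ((q : ℂ)⁻¹) * Polynomial.X) with hP'
    have eP' : ∀ z, P'.eval z = P.eval (z / q) := fun z => by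
      rw [hP', Polynomial.eval_comp]; congr 1; simp; ring
    have dP' : P'.natDegree < n + 3 := by
      have : P'.natDegree ≤ n + 2 := by
        rw [Polynomial.natDegree_le_iff_coeff_eq_zero]
        intro N hN
        rw [hP', Polynomial.comp_C_mul_X_coeff,
          Polynomial.coeff_eq_zero_of_natDegree_lt (by omega), zero_mul]
      omega
    have hL : J w (fun z => z ^ (-((n : ℤ) + 1)) * (φ n).eval (q * z) * (φ n).eval z *
        Vq q a b z) = J w (fun u => u ^ (-((n : ℤ) + 1)) * Q.eval u * (φ n).eval u) :=
      J_congr w fun u _ => by rw [hQ, Polynomial.eval_mul, eV, eφq]; ring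
    have hR : J w (fun z => (z / q) ^ (-((n : ℤ) + 1)) * (φ n).eval (q * (z / q)) *
        (φ n).eval (z / q) * Wq q a b (z / q)) =
        (q : ℂ) ^ (n + 1) * J w (fun u => u ^ (-((n : ℤ) + 1)) * P'.eval u * (φ n).eval u) := by
      rw [← J_const_mul]
      refine J_congr w fun u hu => ?_
      have e1 : (q : ℂ) * (u / q) = u := by field_simp
      have e2 : (u / (q : ℂ)) ^ (-((n : ℤ) + 1)) = (q : ℂ) ^ (n + 1) * u ^ (-((n : ℤ) + 1)) := by
        rw [div_zpow, zpow_neg, zpow_neg, div_inv_eq_mul, mul_comm]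
        norm_cast
      rw [e1, e2, eP', hP, Polynomial.eval_mul, eW]
      ring
    rw [hL, hR, J_poly hw _ _ _ dQ, J_poly hw _ _ _ dP', collapse n (ho n),
      collapse n (ho n)] at h
    rw [h, hP']
    simp only [Polynomial.comp_C_mul_X_coeff]
    ring
  -- expansion
  obtain ⟨K, hK⟩ := rho_bdd hw (φ n) n
  have hqn : ∀ z : ℂ, ‖(q : ℂ) * z‖ ≤ ‖z‖ := fun z => by
    rw [norm_mul, Complex.norm_real, Real.norm_eq_abs, abs_of_pos hq.1]
    nlinarith [norm_nonneg z, hq.2]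
  have hball : ∀ᶠ z in nhdsWithin (0 : ℂ) {0}ᶜ, ‖z‖ < 1 / 2 ∧ z ≠ 0 := by
    have h1 : ∀ᶠ z in nhdsWithin (0 : ℂ) {0}ᶜ, z ∈ Metric.ball (0 : ℂ) (1 / 2) :=
      mem_nhdsWithin_of_mem_nhds (Metric.ball_mem_nhds _ (by norm_num))
    filter_upwards [h1, self_mem_nhdsWithin] with z h1 h2
    exact ⟨by simpa using h1, h2⟩
  have hz0 : Filter.Tendsto (fun z : ℂ => ‖z‖ * K) (nhdsWithin 0 {0}ᶜ) (nhds 0) := by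
    have : Filter.Tendsto (fun z : ℂ => ‖z‖ * K) (nhds 0) (nhds (‖(0 : ℂ)‖ * K)) :=
      Continuous.tendsto (by fun_prop) 0
    rw [norm_zero, zero_mul] at this
    exact tendsto_nhdsWithin_of_tendsto_nhds this
  have hs2 : Filter.Tendsto (fun z => z * rho w (φ n) n z) (nhdsWithin 0 {0}ᶜ) (nhds 0) := by
    refine squeeze_zero_norm' ?_ hz0
    filter_upwards [hball] with z hz
    rw [norm_mul]
    exact mul_le_mul_of_nonneg_left (hK z hz.1) (norm_nonneg z)
  have hs1' : Filter.Tendsto (fun z => z * rho w (φ n) n (q * z)) (nhdsWithin 0 {0}ᶜ)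
      (nhds 0) := by
    refine squeeze_zero_norm' ?_ hz0
    filter_upwards [hball] with z hz
    rw [norm_mul]
    exact mul_le_mul_of_nonneg_left (hK _ ((hqn z).trans_lt hz.1)) (norm_nonneg z)
  have hs1 : Filter.Tendsto (fun z => (q : ℂ) ^ (n + 2) * (z * rho w (φ n) n (q * z)))
      (nhdsWithin 0 {0}ᶜ) (nhds 0) := by
    simpa using hs1'.const_mul ((q : ℂ) ^ (n + 2))
  have eΘ : ∀ z, Θ.eval z = Θ.coeff 0 + Θ.coeff 1 * z := fun z => by
    rw [Polynomial.eval_eq_sum_range' (n := 2) (by omega)]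
    simp [Finset.sum_range_succ]
  obtain ⟨m0, m1⟩ := coeff_match P Q ((q : ℂ) ^ n * c0) ((q : ℂ) ^ (n + 1) * c1) c0 c1
    (α * c0 * Θ.coeff 0) (α * c0 * Θ.coeff 1) _ _ hs1 hs2 (by
      filter_upwards [hball] with z hz
      have hz1 : ‖z‖ < 1 := by linarith [hz.1]
      have h := hΘeq z (norm_pos_iff.2 hz.2) hz1
      rw [eps_expand hw n hn (ho n) z hz1,
        eps_expand hw n hn (ho n) (q * z) ((hqn z).trans_lt hz1), hσ, eΘ] at h
      rw [hP, hQ, Polynomial.eval_mul (p := WW), Polynomial.eval_mul (p := VV), eW, eV, eφq]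
      have hzn : (2 * z ^ n : ℂ) ≠ 0 := mul_ne_zero two_ne_zero (pow_ne_zero n hz.2)
      apply mul_left_cancel₀ hzn
      rw [mul_pow] at h
      simp only [← hc0, ← hc1] at h
      linear_combination -h)
  have t0 : α * Θ.coeff 0 = ((starRingEnd ℂ) a - (starRingEnd ℂ) b * (q : ℂ) ^ n) *
      (φ n).eval 0 := by
    apply mul_left_cancel₀ hσ0
    rw [P0, Q0] at m0
    linear_combination -m0
  have t1 : Θ.coeff 1 = b * (q : ℂ) ^ (n + 1) - a := by
    apply mul_left_cancel₀ (mul_ne_zero hα hσ0)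
    rw [tP, tQ, hS] at hpear
    have k1 : (q : ℂ) ^ (n + 1) * (q : ℂ)⁻¹ = (q : ℂ) ^ n := by field_simp; ring
    have k2 : (q : ℂ) ^ (n + 1) * ((q : ℂ)⁻¹) ^ (n + 2) * q = 1 := by
      rw [inv_pow]; field_simp; ring
    linear_combination -m1 - hpear - P.coeff 1 * c0 * k1 - a * α * c0 * k2
  intro z
  rw [eΘ, t1, mul_div_assoc', ← t0]
  field_simp
  ring
end
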